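/- Assume the rotor ordering satisfies the standard conventions (i) and (ii), and let C ⊆ {1, …, d} be a coclique, i.e. the intervals {η ∈ E_d : e_i < η ≤ −e_i} for i ∈ C are pairwise disjoint. Then for every n ∈ ℕ, 0 ≤ Σ_{i ∈ C} Σ_{v ∈ A_n} v_i ≤ n; in particular the center of mass of the occupied sites lies on or below the hyperplane Σ_{i ∈ C} x_i = 1. -/

import Mathlib

/-- Lattice points of `ℤ^d`. -/
abbrev Zd (d : ℕ) := Fin d → ℤ

/-- The set `E_d = {±e_1, …, ±e_d}` of cardinal directions in `ℤ^d`. -/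
def Ed (d : ℕ) : Set (Zd d) :=
  {v | ∃ i : Fin d, v = Pi.single i 1 ∨ v = Pi.single i (-1)}

/-- Increment an element of `Fin n` by one, cyclically. -/
def finInc {n : ℕ} (j : Fin n) : Fin n :=
  ⟨(j.val + 1) % n, Nat.mod_lt _ (Nat.lt_of_le_of_lt (Nat.zero_le _) j.isLt)⟩

/-- One step of the rotor-router automaton: the particle at `p` moves in the direction
`ε(ℓ(p))` of the rotor at `p`, and that rotor is incremented (cyclically) by one. -/
def rotorStep {d : ℕ} (ε : Fin (2 * d) → Zd d) :
    Zd d × (Zd d → Fin (2 * d)) → Zd d × (Zd d → Fin (2 * d))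
  | (p, ℓ) => (p + ε (ℓ p), Function.update ℓ p (finInc (ℓ p)))

/-- The growth map: run the rotor walk from the origin until it first exits the occupied
region, adjoin the exit point, and give it the first rotor direction. -/
noncomputable def grow {d : ℕ} (hd : 0 < d) (ε : Fin (2 * d) → Zd d) :
    Finset (Zd d) × (Zd d → Fin (2 * d)) → Finset (Zd d) × (Zd d → Fin (2 * d)) :=
  fun c =>
    let N := sInf {n | ((rotorStep ε)^[n] (0, c.2)).1 ∉ c.1}
    let w := (rotorStep ε)^[N] (0, c.2)
    (insert w.1 c.1, Function.update w.2 w.1 ⟨0, by omega⟩)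

/-- The configuration (occupied region, rotors) after `n` particles have been deposited at
the origin and allowed to equilibrate, starting from `A₀ = {0}` and all rotors in the first
position. -/
noncomputable def conf {d : ℕ} (hd : 0 < d) (ε : Fin (2 * d) → Zd d) (n : ℕ) :
    Finset (Zd d) × (Zd d → Fin (2 * d)) :=
  (grow hd ε)^[n] ({0}, fun _ => ⟨0, by omega⟩)

/-- Partial rotor sums. -/
def GG {d : ℕ} (ε : Fin (2 * d) → Zd d) (h : Zd d → ℤ) (c : ℤ) (v : Zd d) (k : Fin (2 * d)) : ℤ :=
  ∑ j ∈ Finset.univ.filter (fun j => j < k), (h (v + ε j) - h v - c)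

theorem GG_inc {d : ℕ} (ε : Fin (2 * d) → Zd d) (h : Zd d → ℤ) (c : ℤ) (v : Zd d)
    (hs : ∑ j, (h (v + ε j) - h v - c) = 0) (k : Fin (2 * d)) :
    GG ε h c v (finInc k) = GG ε h c v k + (h (v + ε k) - h v - c) := by
  have key : ∑ j ∈ insert k (Finset.univ.filter (fun j => j < k)), (h (v + ε j) - h v - c)
      = GG ε h c v k + (h (v + ε k) - h v - c) := by
    rw [Finset.sum_insert (by simp), GG, add_comm]
  rw [← key]
  by_cases hk : k.val + 1 < 2 * d
  · unfold GG
    congr 1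
    ext j
    simp only [Finset.mem_filter, Finset.mem_univ, true_and, Finset.mem_insert, Fin.lt_def,
      Fin.ext_iff, finInc, Nat.mod_eq_of_lt hk]
    omega
  · have h2 : k.val + 1 = 2 * d := by have := k.isLt; omega
    have e1 : insert k (Finset.univ.filter (fun j => j < k)) = Finset.univ := by
      ext j
      simp only [Finset.mem_filter, Finset.mem_univ, true_and, Finset.mem_insert, Fin.lt_def,
        Fin.ext_iff, iff_true]
      have := j.isLt
      omega
    rw [e1, hs]
    unfold GG
    apply Finset.sum_eq_zero
    intro j hj
    simp [Fin.lt_def, finInc, h2] at hj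

theorem walk_inv {d : ℕ} (ε : Fin (2 * d) → Zd d) (h : Zd d → ℤ) (c : ℤ)
    (hs : ∀ v, ∑ j, (h (v + ε j) - h v - c) = 0) (A : Finset (Zd d))
    (x : Zd d × (Zd d → Fin (2 * d))) (t : ℕ)
    (ht : ∀ s < t, ((rotorStep ε)^[s] x).1 ∈ A) :
    ∑ v ∈ A, GG ε h c v (((rotorStep ε)^[t] x).2 v) - ∑ v ∈ A, GG ε h c v (x.2 v)
      = h ((rotorStep ε)^[t] x).1 - h x.1 - c * t := by
  induction t with
  | zero => simp
  | succ t ih =>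
    have ih := ih (fun s hs => ht s (by omega))
    have hm := ht t (by omega)
    rw [Function.iterate_succ_apply']
    generalize (rotorStep ε)^[t] x = y at *
    obtain ⟨p, l⟩ := y
    simp only [rotorStep] at *
    have : ∑ v ∈ A, GG ε h c v (Function.update l p (finInc (l p)) v)
        = ∑ v ∈ A, GG ε h c v (l v) + (h (p + ε (l p)) - h p - c) := by
      rw [← Finset.add_sum_erase _ _ hm, ← Finset.add_sum_erase _ _ hm]
      rw [Function.update_self, GG_inc ε h c p (hs p)]
      have : ∑ v ∈ A.erase p, GG ε h c v (Function.update l p (finInc (l p)) v)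
        = ∑ v ∈ A.erase p, GG ε h c v (l v) := by
        apply Finset.sum_congr rfl
        intro v hv
        rw [Function.update_of_ne (Finset.ne_of_mem_erase hv)]
      rw [this]; ring
    rw [this]
    push_cast
    linarith

theorem sum_dirs {d : ℕ} (ε : Fin (2 * d) → Zd d) (ι : Zd d → Fin (2 * d))
    (hε₂ : ∀ k, ε k ∈ Ed d) (hιε : ∀ k, ι (ε k) = k) (F : Fin (2 * d) → ℤ) :
    ∑ j, F j = ∑ i : Fin d, (F (ι (Pi.single i 1)) + F (ι (Pi.single i (-1)))) := by
  let φ : Fin d ⊕ Fin d → Fin (2 * d) :=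
    Sum.elim (fun i => ι (Pi.single i 1)) (fun i => ι (Pi.single i (-1)))
  have hφ : Function.Bijective φ := by
    rw [Fintype.bijective_iff_surjective_and_card]
    constructor
    · intro k
      obtain ⟨i, hi | hi⟩ := hε₂ k
      · exact ⟨Sum.inl i, by simp only [φ, Sum.elim_inl]; rw [← hi, hιε]⟩
      · exact ⟨Sum.inr i, by simp only [φ, Sum.elim_inr]; rw [← hi, hιε]⟩
    · simp; omega
  rw [← Function.Bijective.sum_comp hφ F, Fintype.sum_sum_type, Finset.sum_add_distrib]
  rfl

theorem mem_Ed_pos {d : ℕ} (i : Fin d) : (Pi.single i 1 : Zd d) ∈ Ed d := ⟨i, Or.inl rfl⟩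
theorem mem_Ed_neg {d : ℕ} (i : Fin d) : (Pi.single i (-1) : Zd d) ∈ Ed d := ⟨i, Or.inr rfl⟩

theorem sq_single {d : ℕ} (v : Zd d) (i : Fin d) (a : ℤ) :
    ∑ k, (v + (Pi.single i a : Zd d)) k ^ 2 = ∑ k, v k ^ 2 + (2 * a * v i + a ^ 2) := by
  have : ∀ k, (v + (Pi.single i a : Zd d)) k ^ 2
      = v k ^ 2 + if k = i then (2 * a * v i + a ^ 2) else 0 := by
    intro k
    by_cases hk : k = i
    · subst hk; simp; ring
    · simp [hk]
  simp_rw [this]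
  simp [Finset.sum_add_distrib]

theorem walk_exits {d : ℕ} (ε : Fin (2 * d) → Zd d) (ι : Zd d → Fin (2 * d))
    (hε₂ : ∀ k, ε k ∈ Ed d) (hιε : ∀ k, ι (ε k) = k) (hει : ∀ v ∈ Ed d, ε (ι v) = v)
    (A : Finset (Zd d)) (x : Zd d × (Zd d → Fin (2 * d))) :
    ∃ t, ((rotorStep ε)^[t] x).1 ∉ A := by
  by_contra! hcon
  let h : Zd d → ℤ := fun v => ∑ k, v k ^ 2
  have hs : ∀ v, ∑ j, (h (v + ε j) - h v - 1) = 0 := by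
    intro v
    rw [sum_dirs ε ι hε₂ hιε]
    apply Finset.sum_eq_zero
    intro i _
    rw [hει _ (mem_Ed_pos i), hει _ (mem_Ed_neg i)]
    simp only [h, sq_single]
    ring
  have hnn : ∀ v, 0 ≤ h v := fun v => Finset.sum_nonneg (fun k _ => sq_nonneg _)
  let B : ℤ := ∑ v ∈ A, ∑ j, |h (v + ε j) - h v - 1|
  have hB : ∀ l : Zd d → Fin (2 * d), |∑ v ∈ A, GG ε h 1 v (l v)| ≤ B := by
    intro l
    refine (Finset.abs_sum_le_sum_abs _ _).trans (Finset.sum_le_sum fun v _ => ?_)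
    refine (Finset.abs_sum_le_sum_abs _ _).trans ?_
    exact Finset.sum_le_sum_of_subset_of_nonneg (Finset.filter_subset _ _)
      (fun _ _ _ => abs_nonneg _)
  let M : ℤ := ∑ v ∈ A, h v
  have hM : 0 ≤ M := Finset.sum_nonneg (fun k _ => hnn _)
  have hB0 : 0 ≤ B := (abs_nonneg _).trans (hB x.2)
  let T : ℕ := (M + 2 * B + 1).toNat
  have hT : (T : ℤ) = M + 2 * B + 1 := Int.toNat_of_nonneg (by linarith)
  have inv := walk_inv ε h 1 hs A x T (fun s _ => hcon s)
  have h1 := abs_le.mp (hB ((rotorStep ε)^[T] x).2)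
  have h2 := abs_le.mp (hB x.2)
  have h3 : h ((rotorStep ε)^[T] x).1 ≤ M :=
    Finset.single_le_sum (f := h) (fun k _ => hnn _) (hcon T)
  have h4 := hnn x.1
  linarith [h1.1, h1.2, h2.1, h2.2]

theorem GG_C {d : ℕ} (ε : Fin (2 * d) → Zd d) (ι : Zd d → Fin (2 * d))
    (hε₂ : ∀ k, ε k ∈ Ed d) (hιε : ∀ k, ι (ε k) = k) (hει : ∀ v ∈ Ed d, ε (ι v) = v)
    (hord₂ : ∀ i : Fin d, ι (Pi.single i 1 : Zd d) < ι (Pi.single i (-1) : Zd d))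
    (C : Finset (Fin d)) (v : Zd d) (k : Fin (2 * d)) :
    GG ε (fun v => ∑ i ∈ C, v i) 0 v k = ((C.filter (fun i =>
      ι (Pi.single i 1 : Zd d) < k ∧ k ≤ ι (Pi.single i (-1) : Zd d))).card : ℤ) := by
  have e : ∀ j, (∑ i ∈ C, (v + ε j) i - ∑ i ∈ C, v i - 0) = ∑ i ∈ C, ε j i := by
    intro j; simp [Finset.sum_add_distrib]
  unfold GG
  simp only [e]
  rw [Finset.sum_comm, Finset.card_filter]
  push_cast
  apply Finset.sum_congr rfl
  intro i _
  rw [Finset.sum_filter, sum_dirs ε ι hε₂ hιε]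
  rw [Finset.sum_eq_single i]
  · rw [hει _ (mem_Ed_pos i), hει _ (mem_Ed_neg i)]
    have := hord₂ i
    simp only [Pi.single_eq_same]
    split_ifs <;> grind
  · intro b _ hb
    rw [hει _ (mem_Ed_pos b), hει _ (mem_Ed_neg b)]
    simp [Pi.single_eq_of_ne hb.symm]
  · simp

theorem sum_C_zero {d : ℕ} (ε : Fin (2 * d) → Zd d) (ι : Zd d → Fin (2 * d))
    (hε₂ : ∀ k, ε k ∈ Ed d) (hιε : ∀ k, ι (ε k) = k) (hει : ∀ v ∈ Ed d, ε (ι v) = v)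
    (C : Finset (Fin d)) (v : Zd d) :
    ∑ j, ((fun v : Zd d => ∑ i ∈ C, v i) (v + ε j) - (fun v : Zd d => ∑ i ∈ C, v i) v - 0) = 0 := by
  rw [sum_dirs ε ι hε₂ hιε]
  apply Finset.sum_eq_zero
  intro b _
  rw [hει _ (mem_Ed_pos b), hει _ (mem_Ed_neg b)]
  simp only [Pi.add_apply, Finset.sum_add_distrib]
  have : ∑ i ∈ C, (Pi.single b (-1) : Zd d) i = - ∑ i ∈ C, (Pi.single b 1 : Zd d) i := by
    rw [← Finset.sum_neg_distrib]
    refine Finset.sum_congr rfl fun i _ => ?_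
    rw [Pi.single_neg]; rfl
  rw [this]; ring

theorem conf_inv {d : ℕ} (hd : 0 < d) (ε : Fin (2 * d) → Zd d) (ι : Zd d → Fin (2 * d))
    (hε₂ : ∀ k, ε k ∈ Ed d) (hιε : ∀ k, ι (ε k) = k) (hει : ∀ v ∈ Ed d, ε (ι v) = v)
    (C : Finset (Fin d)) (n : ℕ) :
    (conf hd ε n).1.card ≤ n + 1 ∧ (∃ q ∈ (conf hd ε n).1, (conf hd ε n).2 q = ⟨0, by omega⟩) ∧
    ∑ v ∈ (conf hd ε n).1, ∑ i ∈ C, v i =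
      ∑ v ∈ (conf hd ε n).1, GG ε (fun v => ∑ i ∈ C, v i) 0 v ((conf hd ε n).2 v) := by
  have GG0 : ∀ v, GG ε (fun v => ∑ i ∈ C, v i) 0 v ⟨0, by omega⟩ = 0 := by
    intro v; simp [GG, Fin.lt_def]
  induction n with
  | zero => 
    simp [conf, GG0]
  | succ n ih =>
    have hc : conf hd ε (n + 1) = grow hd ε (conf hd ε n) := by
      simp only [conf, Function.iterate_succ_apply']
    rw [hc]
    generalize conf hd ε n = c at *
    obtain ⟨A, l⟩ := c
    obtain ⟨h1, -, h3⟩ := ih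
    simp only at h1 h3
    unfold grow
    simp only
    set N := sInf {n | ((rotorStep ε)^[n] (0, l)).1 ∉ A} with hN
    have hne : {n | ((rotorStep ε)^[n] (0, l)).1 ∉ A}.Nonempty :=
      walk_exits ε ι hε₂ hιε hει A (0, l)
    have hq : ((rotorStep ε)^[N] (0, l)).1 ∉ A := Nat.sInf_mem hne
    have hlt : ∀ s < N, ((rotorStep ε)^[s] (0, l)).1 ∈ A := by
      intro s hs
      by_contra hcon
      exact Nat.notMem_of_lt_sInf hs hcon
    have inv := walk_inv ε (fun v => ∑ i ∈ C, v i) 0 (sum_C_zero ε ι hε₂ hιε hει C) A (0, l) N hlt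
    generalize (rotorStep ε)^[N] (0, l) = w at *
    refine ⟨(Finset.card_insert_le _ _).trans (by omega), ⟨w.1, by simp, by simp⟩, ?_⟩
    rw [Finset.sum_insert hq, Finset.sum_insert hq, Function.update_self, GG0]
    have : ∑ v ∈ A, GG ε (fun v => ∑ i ∈ C, v i) 0 v (Function.update w.2 w.1 ⟨0, by omega⟩ v)
        = ∑ v ∈ A, GG ε (fun v => ∑ i ∈ C, v i) 0 v (w.2 v) := by
      refine Finset.sum_congr rfl fun v hv => ?_
      rw [Function.update_of_ne (by rintro rfl; exact hq hv)]
    rw [this, h3]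
    simp at inv
    linarith

/-- If the rotor ordering satisfies the standard conventions and `C ⊆ {1, …, d}` is a
coclique — the intervals `{η ∈ E_d : e_i < η ≤ −e_i}`, `i ∈ C`, are pairwise disjoint —
then for every `n`, `0 ≤ Σ_{i ∈ C} Σ_{v ∈ A_n} v_i ≤ n`; in particular the center of mass
of the occupied sites lies on or below the hyperplane `Σ_{i ∈ C} x_i = 1`. -/
theorem center_of_mass_below_coclique_hyperplane (d : ℕ) (hd : 0 < d)
    (ε : Fin (2 * d) → Zd d) (ι : Zd d → Fin (2 * d))
    (hε₂ : ∀ k, ε k ∈ Ed d) (hιε : ∀ k, ι (ε k) = k) (hει : ∀ v ∈ Ed d, ε (ι v) = v)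
    (hord₁ : ∀ i j : Fin d, i < j →
      ι (Pi.single i 1 : Zd d) < ι (Pi.single j 1 : Zd d))
    (hord₂ : ∀ i : Fin d, ι (Pi.single i 1 : Zd d) < ι (Pi.single i (-1) : Zd d))
    (C : Finset (Fin d))
    (hC : ∀ i ∈ C, ∀ j ∈ C, i ≠ j → ∀ k : Fin (2 * d),
      ¬((ι (Pi.single i 1 : Zd d) < k ∧ k ≤ ι (Pi.single i (-1) : Zd d)) ∧
        (ι (Pi.single j 1 : Zd d) < k ∧ k ≤ ι (Pi.single j (-1) : Zd d))))
    (n : ℕ) :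
    (0 ≤ ∑ i ∈ C, ∑ v ∈ (conf hd ε n).1, v i ∧
      ∑ i ∈ C, ∑ v ∈ (conf hd ε n).1, v i ≤ (n : ℤ)) ∧
    ∑ i ∈ C, (∑ v ∈ (conf hd ε n).1, (v i : ℝ)) / ((conf hd ε n).1.card : ℝ) ≤ 1 := by
  have hG : ∀ v k, 0 ≤ GG ε (fun v => ∑ i ∈ C, v i) 0 v k ∧
      GG ε (fun v => ∑ i ∈ C, v i) 0 v k ≤ 1 := by
    intro v k
    rw [GG_C ε ι hε₂ hιε hει hord₂ C v k]
    refine ⟨by positivity, ?_⟩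
    norm_cast
    rw [Finset.card_le_one]
    intro a ha b hb
    simp only [Finset.mem_filter] at ha hb
    by_contra hab
    exact hC a ha.1 b hb.1 hab k ⟨ha.2, hb.2⟩
  obtain ⟨h1, ⟨q, hqA, hq⟩, h3⟩ := conf_inv hd ε ι hε₂ hιε hει C n
  generalize conf hd ε n = c at *
  obtain ⟨A, l⟩ := c
  simp only at *
  have hnn : 0 ≤ ∑ i ∈ C, ∑ v ∈ A, v i := by
    rw [Finset.sum_comm, h3]
    exact Finset.sum_nonneg fun v _ => (hG v _).1
  have hle : ∑ i ∈ C, ∑ v ∈ A, v i ≤ (A.card : ℤ) - 1 := by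
    rw [Finset.sum_comm, h3, ← Finset.add_sum_erase _ _ hqA, hq]
    have e0 : GG ε (fun v => ∑ i ∈ C, v i) 0 q ⟨0, by omega⟩ = 0 := by simp [GG, Fin.lt_def]
    rw [e0, zero_add]
    refine (Finset.sum_le_card_nsmul _ _ 1 fun v _ => (hG v _).2).trans ?_
    have := Finset.card_erase_add_one hqA
    simp only [nsmul_eq_mul, mul_one]
    omega
  refine ⟨⟨hnn, by omega⟩, ?_⟩
  rw [← Finset.sum_div]
  apply div_le_one_of_le₀ _ (by positivity)
  have : ∑ i ∈ C, ∑ v ∈ A, v i ≤ (A.card : ℤ) := by omega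
  exact_mod_cast this
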